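/- For all n ≥ 2, b(n,2) = p(n,2) = 3·E(n−1,2) − 2·C(n,3) + C(n,2) − 1, where C(n,k) denotes the binomial coefficient. -/

import Mathlib

open Finset
open scoped Classical

/-- The one-line word of a permutation of `Fin n`, with values in `{1, …, n}`. -/
def permWord {n : ℕ} (π : Equiv.Perm (Fin n)) : List ℕ :=
  (List.finRange n).map fun i => (π i : ℕ) + 1

/-- The set of (0-indexed) ascent positions of a word. Position `i` (for
`0 ≤ i ≤ length - 2`) is an ascent if `w_i < w_{i+1}`. -/
def ascentSet (w : List ℕ) : Finset ℕ :=
  (Finset.range (w.length - 1)).filter fun i => w.getD i 0 < w.getD (i + 1) 0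

/-- The set of (0-indexed) descent positions of a word. Position `i` (for
`0 ≤ i ≤ length - 2`) is a descent if `w_i > w_{i+1}`. -/
def descentSet (w : List ℕ) : Finset ℕ :=
  (Finset.range (w.length - 1)).filter fun i => w.getD (i + 1) 0 < w.getD i 0

/-- The number of descents of a permutation. -/
def descentCount {n : ℕ} (π : Equiv.Perm (Fin n)) : ℕ :=
  (descentSet (permWord π)).card

/-- A permutation is ballot if every prefix of its one-line notation has at least
as many ascents as descents. -/
def IsBallot {n : ℕ} (π : Equiv.Perm (Fin n)) : Prop :=
  ∀ k, k ≤ n →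
    (descentSet ((permWord π).take k)).card ≤ (ascentSet ((permWord π).take k)).card

/-- The Eulerian number `E(n,d)`: the number of permutations of `{1,…,n}` with
exactly `d` descents.  (`E(0,0) = 1` and `E(0,d) = 0` for `d ≥ 1`.) -/
noncomputable def eulerianNum (n d : ℕ) : ℕ :=
  (Finset.univ.filter fun π : Equiv.Perm (Fin n) => descentCount π = d).card

/-- `M(c)` for a cycle `c`: the minimum of the number of cyclic ascents and the
number of cyclic descents of `c`. -/
noncomputable def cycleM {n : ℕ} (c : Equiv.Perm (Fin n)) : ℕ :=
  min ((c.support.filter fun x => x < c x).card) ((c.support.filter fun x => c x < x).card)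

/-- `M(π)`: the sum of `M(c)` over the cycles `c` of the cycle decomposition of `π`
(fixed points contribute `0`). -/
noncomputable def permM {n : ℕ} (π : Equiv.Perm (Fin n)) : ℕ :=
  ∑ c ∈ π.cycleFactorsFinset, cycleM c

/-- The number of ballot permutations of `{1,…,n}`. -/
noncomputable def ballotTotal (n : ℕ) : ℕ :=
  (Finset.univ.filter fun π : Equiv.Perm (Fin n) => IsBallot π).card

/-- The number of permutations of `{1,…,n}` of odd order. -/
noncomputable def oddOrderTotal (n : ℕ) : ℕ :=
  (Finset.univ.filter fun π : Equiv.Perm (Fin n) => Odd (orderOf π)).card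

/-- `b(n,d)`: the number of ballot permutations of `{1,…,n}` with exactly `d` descents. -/
noncomputable def bCount (n d : ℕ) : ℕ :=
  (Finset.univ.filter fun π : Equiv.Perm (Fin n) => IsBallot π ∧ descentCount π = d).card

/-- `p(n,d)`: the number of odd order permutations `π` of `{1,…,n}` with `M(π) = d`. -/
noncomputable def pCount (n d : ℕ) : ℕ :=
  (Finset.univ.filter fun π : Equiv.Perm (Fin n) => Odd (orderOf π) ∧ permM π = d).card

/-- The Eulerian–Catalan numbers: `EC(n) = 2·E(2n, n-1)`, with `EC(0) = 1`. -/
noncomputable def eulerianCatalan (n : ℕ) : ℕ :=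
  if n = 0 then 1 else 2 * eulerianNum (2 * n) (n - 1)

/-- The descent positions of a permutation. -/
def descentPositions {n : ℕ} (π : Equiv.Perm (Fin n)) : Finset ℕ :=
  descentSet (permWord π)

theorem permWord_length {n : ℕ} (π : Equiv.Perm (Fin n)) : (permWord π).length = n := by
  simp [permWord]

theorem permWord_getD {n : ℕ} (π : Equiv.Perm (Fin n)) (i : ℕ) (h : i < n) :
    (permWord π).getD i 0 = (π ⟨i, h⟩ : ℕ) + 1 := by
  simp [permWord, h]

theorem mem_descentPositions {n : ℕ} {π : Equiv.Perm (Fin n)} {i : ℕ} :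
    i ∈ descentPositions π ↔
      ∃ h : i + 1 < n, π ⟨i + 1, h⟩ < π ⟨i, Nat.lt_of_succ_lt h⟩ := by
  unfold descentPositions descentSet
  rw [mem_filter, permWord_length, mem_range]
  constructor
  · rintro ⟨h1, h2⟩
    have h : i + 1 < n := by omega
    rw [permWord_getD π i (by omega), permWord_getD π (i + 1) h] at h2
    exact ⟨h, Fin.lt_def.2 (by omega)⟩
  · rintro ⟨h, h2⟩
    rw [permWord_getD π i (by omega), permWord_getD π (i + 1) h]
    exact ⟨by omega, by have := Fin.lt_def.1 h2; omega⟩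

theorem descentPositions_subset_range {n : ℕ} (π : Equiv.Perm (Fin n)) :
    descentPositions π ⊆ range (n - 1) := by
  intro i hi
  obtain ⟨h, -⟩ := mem_descentPositions.1 hi
  simp only [mem_range]; omega

theorem descentSet_take {n : ℕ} (π : Equiv.Perm (Fin n)) {k : ℕ} (hk : k ≤ n) :
    descentSet ((permWord π).take k) = {i ∈ descentPositions π | i < k - 1} := by
  ext i
  simp only [descentPositions, descentSet, mem_filter, mem_range, List.length_take,
    permWord_length, List.getD_eq_getElem?_getD, List.getElem?_take]
  constructor
  · rintro ⟨h1, h2⟩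
    rw [if_pos (by omega), if_pos (by omega)] at h2
    exact ⟨⟨by omega, h2⟩, by omega⟩
  · rintro ⟨⟨h1, h2⟩, h3⟩
    rw [if_pos (by omega), if_pos (by omega)]
    exact ⟨by omega, h2⟩

theorem ascentSet_take {n : ℕ} (π : Equiv.Perm (Fin n)) {k : ℕ} (hk : k ≤ n) :
    ascentSet ((permWord π).take k) = range (k - 1) \ descentSet ((permWord π).take k) := by
  rw [descentSet_take π hk]
  ext i
  simp only [ascentSet, mem_filter, mem_range, List.length_take, mem_sdiff,
    permWord_length, List.getD_eq_getElem?_getD, List.getElem?_take]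
  have key : ∀ h : i + 1 < n, ((permWord π)[i]?.getD 0 < (permWord π)[i + 1]?.getD 0 ↔
      i ∉ descentPositions π) := by
    intro h
    rw [← List.getD_eq_getElem?_getD, ← List.getD_eq_getElem?_getD,
      permWord_getD π i (by omega), permWord_getD π (i + 1) h, mem_descentPositions]
    have hne : π ⟨i, by omega⟩ ≠ π ⟨i + 1, h⟩ := by
      intro he
      have := congrArg Fin.val (π.injective he)
      simp at this
    have hne' : (π ⟨i, by omega⟩ : ℕ) ≠ π ⟨i + 1, h⟩ := fun he => hne (Fin.ext he)
    simp only [h, exists_true_left, Fin.lt_def]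
    omega
  constructor
  · rintro ⟨h1, h2⟩
    rw [if_pos (by omega), if_pos (by omega), key (by omega)] at h2
    exact ⟨by omega, fun h => h2 h.1⟩
  · rintro ⟨h1, h2⟩
    rw [if_pos (by omega), if_pos (by omega), key (by omega)]
    exact ⟨by omega, fun h => h2 ⟨h, h1⟩⟩

theorem isBallot_iff {n : ℕ} (π : Equiv.Perm (Fin n)) :
    IsBallot π ↔ ∀ m, m ≤ n - 1 → 2 * #{i ∈ descentPositions π | i < m} ≤ m := by
  have key : ∀ k, k ≤ n →
      ((#(descentSet ((permWord π).take k)) ≤ #(ascentSet ((permWord π).take k))) ↔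
        2 * #{i ∈ descentPositions π | i < k - 1} ≤ k - 1) := by
    intro k hk
    have hsub : {i ∈ descentPositions π | i < k - 1} ⊆ range (k - 1) := by
      intro i hi
      simpa using (mem_filter.1 hi).2
    rw [ascentSet_take π hk, descentSet_take π hk, card_sdiff_of_subset hsub, card_range]
    have := card_le_card hsub
    rw [card_range] at this
    omega
  unfold IsBallot
  constructor
  · intro h m hm
    rcases Nat.eq_zero_or_pos m with rfl | hm0
    · simp
    have := (key (m + 1) (by omega)).1 (h (m + 1) (by omega))
    simpa using this
  · intro h k hk
    exact (key k hk).2 (h _ (by omega))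

theorem isBallot_iff_of_descentPositions_eq_pair {n p q : ℕ} {π : Equiv.Perm (Fin n)}
    (hpq : p < q) (hD : descentPositions π = {p, q}) : IsBallot π ↔ 1 ≤ p ∧ 3 ≤ q := by
  have hq : q < n - 1 := by
    have := descentPositions_subset_range π (hD ▸ (by simp : q ∈ ({p, q} : Finset ℕ)))
    simpa using this
  rw [isBallot_iff, hD]
  constructor
  · intro h
    have h1 := h (p + 1) (by omega)
    have h2 := h (q + 1) (by omega)
    rw [filter_insert, filter_singleton, if_pos (by omega), if_neg (by omega)] at h1
    rw [filter_insert, filter_singleton, if_pos (by omega), if_pos (by omega),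
      card_pair (by omega)] at h2
    simp at h1
    omega
  · rintro ⟨h1, h2⟩ m hm
    rw [filter_insert, filter_singleton]
    split_ifs
    · rw [card_pair (by omega)]; omega
    · simp; omega
    · omega
    · simp

/-- The inclusion-exclusion expression for the number of permutations of `n` letters whose
increasing runs are the first `i` letters, the next `j - i` letters and the rest. -/
def pairCount (n i j : ℕ) : ℤ :=
  n.choose j * j.choose i - n.choose i - n.choose j + 1

theorem IsLowerSet.finset_eq_of_card_eq {α : Type*} [LinearOrder α] {s t : Finset α}
    (hs : IsLowerSet (s : Set α)) (ht : IsLowerSet (t : Set α)) (h : #s = #t) : s = t := by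
  rcases hs.total ht with h' | h'
  · exact eq_of_subset_of_card_le (by exact_mod_cast h') h.ge
  · exact (eq_of_subset_of_card_le (by exact_mod_cast h') h.le).symm

theorem card_filter_val_le {n p : ℕ} (hp : p < n) :
    #{x : Fin n | (x : ℕ) ≤ p} = p + 1 := by
  have : ({x : Fin n | (x : ℕ) ≤ p} : Finset (Fin n)) = Iic ⟨p, hp⟩ := by
    ext x; simp [Fin.le_def]
  rw [this, Fin.card_Iic]

theorem lt_of_forall_not_mem_descentPositions {n : ℕ} {π : Equiv.Perm (Fin n)} {x : ℕ}
    (hx : x < n) (y : ℕ) (hxy : x < y) (hy : y < n)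
    (h : ∀ r, x ≤ r → r < y → r ∉ descentPositions π) : π ⟨x, hx⟩ < π ⟨y, hy⟩ := by
  induction y, hxy using Nat.le_induction with
  | base =>
    have := h x le_rfl (by omega)
    rw [mem_descentPositions] at this
    push Not at this
    refine lt_of_le_of_ne (this hy) fun he => ?_
    have := congrArg Fin.val (π.injective he)
    simp at this
  | succ y hxy ih =>
    refine (ih (by omega) fun r h1 h2 => h r h1 (by omega)).trans ?_
    have := h y (by omega) (by omega)
    rw [mem_descentPositions] at this
    push Not at this
    refine lt_of_le_of_ne (this hy) fun he => ?_
    have := congrArg Fin.val (π.injective he)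
    simp at this

/-- The index of the block of `x` in a chain `A ⊆ B`. -/
noncomputable def chainLevel {α : Type*} (A B : Finset α) (x : α) : ℕ :=
  if x ∈ A then 0 else if x ∈ B then 1 else 2

theorem eq_sort_chainLevel_of_descentPositions_subset {n p q : ℕ} (hpq : p ≤ q)
    {π : Equiv.Perm (Fin n)} (hD : descentPositions π ⊆ {p, q}) :
    π = Tuple.sort (chainLevel (image π {x : Fin n | (x : ℕ) ≤ p})
      (image π {x : Fin n | (x : ℕ) ≤ q})) := by
  have hlev : ∀ x : Fin n, chainLevel (image π {x : Fin n | (x : ℕ) ≤ p})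
      (image π {x : Fin n | (x : ℕ) ≤ q}) (π x) =
      if (x : ℕ) ≤ p then 0 else if (x : ℕ) ≤ q then 1 else 2 := by
    intro x
    simp [chainLevel]
  rw [Tuple.eq_sort_iff]
  constructor
  · intro x y hxy
    have := Fin.le_def.1 hxy
    simp only [Function.comp, hlev]
    split_ifs <;> omega
  · intro x y hxy he
    rw [hlev, hlev] at he
    have hxy' := Fin.lt_def.1 hxy
    refine lt_of_forall_not_mem_descentPositions x.2 y hxy' y.2 fun r h1 h2 hr => ?_
    have := hD hr
    simp only [mem_insert, mem_singleton] at this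
    split_ifs at he <;> omega

theorem card_descentPositions_subset_pair {n p q : ℕ} (hpq : p ≤ q) (hq : q < n) :
    #{π : Equiv.Perm (Fin n) | descentPositions π ⊆ {p, q}} =
      n.choose (q + 1) * (q + 1).choose (p + 1) := by
  have hcard : #((powersetCard (q + 1) (univ : Finset (Fin n))).sigma
      fun B => powersetCard (p + 1) B) = n.choose (q + 1) * (q + 1).choose (p + 1) := by
    rw [card_sigma, sum_congr rfl (g := fun _ => (q + 1).choose (p + 1))]
    · simp
    · intro B hB
      rw [card_powersetCard, (mem_powersetCard.1 hB).2]
  rw [← hcard]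
  refine card_bij (fun π _ => ⟨image π {x : Fin n | (x : ℕ) ≤ q},
    image π {x : Fin n | (x : ℕ) ≤ p}⟩) ?_ ?_ ?_
  · intro π _
    simp only [mem_sigma, mem_powersetCard, subset_univ, true_and]
    rw [card_image_of_injective _ π.injective, card_image_of_injective _ π.injective,
      card_filter_val_le hq, card_filter_val_le (by omega)]
    refine ⟨rfl, image_subset_image fun x => ?_, rfl⟩
    simp only [mem_filter, mem_univ, true_and]
    omega
  · intro π hπ σ hσ h
    simp only [Sigma.mk.injEq, heq_eq_eq] at h
    rw [eq_sort_chainLevel_of_descentPositions_subset hpq (mem_filter.1 hπ).2,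
      eq_sort_chainLevel_of_descentPositions_subset hpq (mem_filter.1 hσ).2, h.1, h.2]
  · rintro ⟨B, A⟩ h
    simp only [mem_sigma, mem_powersetCard, subset_univ, true_and] at h
    obtain ⟨hB, hAB, hA⟩ := h
    set w : Fin n → ℕ := chainLevel A B with hw
    set π := Tuple.sort w with hπ
    obtain ⟨hmono, hinc⟩ := (Tuple.eq_sort_iff (f := w) (σ := π)).1 rfl
    have hwA : ∀ x, x ∈ A ↔ w x ≤ 0 := by
      intro x
      simp only [hw, chainLevel]
      split_ifs <;> simp_all
    have hwB : ∀ x, x ∈ B ↔ w x ≤ 1 := by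
      intro x
      simp only [hw, chainLevel]
      split_ifs with h1 h2
      · simp [hAB h1]
      · simp [h2]
      · simp [h2]
    have himage : ∀ (C : Finset (Fin n)) (c r : ℕ), r < n → #C = r + 1 →
        (∀ x, x ∈ C ↔ w x ≤ c) → image π {x : Fin n | (x : ℕ) ≤ r} = C := by
      intro C c r hr hC hCw
      have : ({x : Fin n | (x : ℕ) ≤ r} : Finset (Fin n)) = image π.symm C := by
        apply IsLowerSet.finset_eq_of_card_eq
        · intro x y hyx hx
          simp only [coe_filter, mem_univ, true_and, Set.mem_ofPred_eq] at hx ⊢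
          exact (Fin.le_def.1 hyx).trans hx
        · intro x y hyx hx
          simp only [coe_image, Set.mem_image, mem_coe] at hx ⊢
          obtain ⟨z, hz, rfl⟩ := hx
          refine ⟨π y, ?_, by simp⟩
          rw [hCw] at hz ⊢
          have := hmono hyx
          simp only [Function.comp, Equiv.apply_symm_apply] at this
          exact this.trans hz
        · rw [card_filter_val_le hr, card_image_of_injective _ π.symm.injective, hC]
      rw [this, image_image]
      simp
    have hiA := himage A 0 p (by omega) hA hwA
    have hiB := himage B 1 q hq hB hwB
    refine ⟨π, ?_, by rw [hiA, hiB]⟩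
    simp only [mem_filter, mem_univ, true_and]
    intro r hr
    obtain ⟨hrn, hlt⟩ := mem_descentPositions.1 hr
    by_contra hne
    simp only [mem_insert, mem_singleton, not_or] at hne
    have hlev : ∀ x : Fin n, w (π x) =
        if (x : ℕ) ≤ p then 0 else if (x : ℕ) ≤ q then 1 else 2 := by
      intro x
      rw [hw, ← hiA, ← hiB]
      simp [chainLevel]
    refine lt_asymm hlt (hinc ⟨r, by omega⟩ ⟨r + 1, hrn⟩ (Fin.lt_def.2 (by simp)) ?_)
    rw [hlev, hlev]
    simp only
    split_ifs <;> omega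

theorem card_descentPositions_eq_pair {n p q : ℕ} (hpq : p < q) (hq : q < n - 1) :
    (#{π : Equiv.Perm (Fin n) | descentPositions π = {p, q}} : ℤ) =
      pairCount n (p + 1) (q + 1) := by
  have h0 : ∀ π : Equiv.Perm (Fin n), descentPositions π ⊆ {n - 1, n - 1} ↔
      descentPositions π = ∅ := by
    intro π
    refine ⟨fun h => ?_, fun h => by simp [h]⟩
    refine eq_empty_of_forall_notMem fun x hx => ?_
    have h1 := h hx
    have h2 := descentPositions_subset_range π hx
    simp at h1 h2
    omega
  have a0 := card_descentPositions_subset_pair (n := n) (le_refl (n - 1)) (by omega)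
  have ap := card_descentPositions_subset_pair (n := n) (le_refl p) (by omega)
  have aq := card_descentPositions_subset_pair (n := n) (le_refl q) (by omega)
  have apq := card_descentPositions_subset_pair (n := n) hpq.le (by omega)
  simp only [h0] at a0
  rw [show n - 1 + 1 = n by omega] at a0
  simp only [Nat.choose_self, mul_one] at a0 ap aq
  have hsingle : ∀ r, #{π : Equiv.Perm (Fin n) | descentPositions π ⊆ {r, r}} =
      #{π : Equiv.Perm (Fin n) | descentPositions π = ∅} +
      #{π : Equiv.Perm (Fin n) | descentPositions π = {r}} := by
    intro r
    rw [← card_union_of_disjoint, ← filter_or]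
    · congr 1
      ext π
      simp [subset_singleton_iff]
    · rw [disjoint_filter]
      intro π _ h1 h2
      simp [h1] at h2
  have hpair : #{π : Equiv.Perm (Fin n) | descentPositions π ⊆ {p, q}} =
      #{π : Equiv.Perm (Fin n) | descentPositions π = ∅} +
      #{π : Equiv.Perm (Fin n) | descentPositions π = {p}} +
      #{π : Equiv.Perm (Fin n) | descentPositions π = {q}} +
      #{π : Equiv.Perm (Fin n) | descentPositions π = {p, q}} := by
    rw [← card_union_of_disjoint, ← filter_or, ← card_union_of_disjoint, ← filter_or,
      ← card_union_of_disjoint, ← filter_or]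
    · congr 1
      ext π
      simp only [mem_filter, mem_univ, true_and, or_assoc]
      rw [← coe_subset, coe_pair, Set.subset_pair_iff_eq]
      norm_cast
    · rw [disjoint_filter]
      intro π _ h1 h2
      have : #(descentPositions π) = 2 := by rw [h2, card_pair hpq.ne]
      rcases h1 with (h1 | h1) | h1 <;> simp [h1] at this
    · rw [disjoint_filter]
      intro π _ h1 h2
      rcases h1 with h1 | h1 <;> rw [h1] at h2
      · simp at h2
      · simp at h2; omega
    · rw [disjoint_filter]
      intro π _ h1 h2
      simp [h1] at h2
  rw [hsingle] at ap aq
  rw [hpair] at apq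
  unfold pairCount
  zify at ap aq apq a0
  linarith
theorem card_two_descents {n : ℕ} (P : Equiv.Perm (Fin n) → Prop) (R : ℕ → ℕ → Prop)
    [DecidableRel R]
    (hPR : ∀ π p q, p < q → descentPositions π = {p, q} → (P π ↔ R p q)) :
    (#{π : Equiv.Perm (Fin n) | P π ∧ descentCount π = 2} : ℤ) =
      ∑ q ∈ range (n - 1), ∑ p ∈ range q,
        if R p q then pairCount n (p + 1) (q + 1) else 0 := by
  have hset : ({π : Equiv.Perm (Fin n) | P π ∧ descentCount π = 2} : Finset _) =
      ((range (n - 1)).sigma fun q => {p ∈ range q | R p q}).biUnion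
        fun x => {π : Equiv.Perm (Fin n) | descentPositions π = {x.2, x.1}} := by
    ext π
    simp only [mem_filter, mem_univ, true_and, mem_biUnion, mem_sigma, mem_range, Sigma.exists]
    constructor
    · rintro ⟨hP, hD⟩
      obtain ⟨p, q, hne, hpq⟩ := card_eq_two.1 hD
      change descentPositions π = _ at hpq
      have hsub := descentPositions_subset_range π
      rw [hpq, insert_subset_iff, singleton_subset_iff, mem_range, mem_range] at hsub
      rcases lt_or_gt_of_ne hne with h | h
      · exact ⟨q, p, ⟨hsub.2, h, (hPR π p q h hpq).1 hP⟩, hpq⟩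
      · rw [pair_comm] at hpq
        exact ⟨p, q, ⟨hsub.1, h, (hPR π q p h hpq).1 hP⟩, hpq⟩
    · rintro ⟨q, p, ⟨hq, hp, hR⟩, hD⟩
      refine ⟨(hPR π p q hp hD).2 hR, ?_⟩
      change #(descentPositions π) = 2
      rw [hD, card_pair hp.ne]
  rw [hset, card_biUnion]
  · rw [sum_sigma]
    push_cast
    refine sum_congr rfl fun q hq => ?_
    rw [sum_filter]
    refine sum_congr rfl fun p hp => ?_
    split_ifs
    · exact card_descentPositions_eq_pair (mem_range.1 hp) (mem_range.1 hq)
    · rfl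
  · rintro ⟨q, p⟩ h ⟨q', p'⟩ h' hne
    simp only [coe_sigma, Set.mem_sigma_iff, mem_coe, mem_filter, mem_range] at h h'
    rw [Function.onFun, disjoint_filter]
    intro π _ h1 h2
    apply hne
    rw [h1] at h2
    have e1 : p ∈ ({p', q'} : Finset ℕ) := by rw [← h2]; simp
    have e2 : q ∈ ({p', q'} : Finset ℕ) := by rw [← h2]; simp
    have e3 : p' ∈ ({p, q} : Finset ℕ) := by rw [h2]; simp
    simp only [mem_insert, mem_singleton] at e1 e2 e3
    have : p = p' := by omega
    have : q = q' := by omega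
    subst_vars
    rfl

theorem sum_choose_mul_pow {R : Type*} [CommRing R] (n : ℕ) (a : R) :
    ∑ k ∈ range (n + 1), (n.choose k : R) * a ^ k = (1 + a) ^ n := by
  rw [add_comm (1 : R) a, add_pow]
  refine sum_congr rfl fun k _ => ?_
  rw [one_pow]; ring

theorem sum_choose_mul_pow_mul {R : Type*} [CommRing R] (n : ℕ) (a : R) :
    ∑ k ∈ range (n + 2), ((n + 1).choose k : R) * (a ^ k * k) = (n + 1) * a * (1 + a) ^ n := by
  rw [sum_range_succ', ← sum_choose_mul_pow, mul_sum]
  simp only [Nat.cast_zero, mul_zero, add_zero]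
  refine sum_congr rfl fun k _ => ?_
  have h := congrArg (Nat.cast : ℕ → R) (Nat.add_one_mul_choose_eq n k)
  push_cast at h ⊢
  linear_combination -(a ^ (k + 1)) * h

theorem sum_range_sum_range_succ (f : ℕ → ℤ) (N : ℕ) :
    ∑ j ∈ range N, ∑ i ∈ range (j + 1), f i = ∑ i ∈ range N, ((N : ℤ) - i) * f i := by
  induction N with
  | zero => simp
  | succ N ih =>
    rw [sum_range_succ, ih, sum_range_succ _ N, sum_range_succ _ N, ← add_assoc,
      ← sum_add_distrib]
    push_cast
    congr 1
    · exact sum_congr rfl fun i _ => by ring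
    · ring

theorem pairCount_zero_left (n j : ℕ) : pairCount n 0 j = 0 := by
  simp [pairCount]

theorem pairCount_self_right (n i : ℕ) : pairCount n i n = 0 := by
  simp [pairCount]

theorem sum_pairCount (m : ℕ) :
    ∑ q ∈ range m, ∑ p ∈ range q, pairCount (m + 1) (p + 1) (q + 1) =
      3 ^ (m + 1) - (m + 2) * 2 ^ (m + 1) + (m + 2).choose 2 := by
  have hrow : ∀ j, ∑ i ∈ range j, pairCount (m + 1) i j =
      (m + 1).choose j * 2 ^ j - ∑ i ∈ range (j + 1), ((m + 1).choose i : ℤ)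
        - (m + 1).choose j * j + j := by
    intro j
    have h := sum_choose_mul_pow j (1 : ℤ)
    simp only [one_pow, mul_one] at h
    rw [sum_range_succ, Nat.choose_self] at h
    simp only [pairCount, sum_add_distrib, sum_sub_distrib, ← mul_sum, sum_const, card_range,
      sum_range_succ _ j]
    rw [eq_sub_of_add_eq h]
    simp only [nsmul_eq_mul]
    push_cast
    ring
  have hext : ∑ q ∈ range m, ∑ p ∈ range q, pairCount (m + 1) (p + 1) (q + 1) =
      ∑ j ∈ range (m + 2), ∑ i ∈ range j, pairCount (m + 1) i j := by
    rw [sum_range_succ _ (m + 1), sum_range_succ' _ m]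
    simp only [pairCount_self_right, sum_const_zero, range_zero, sum_empty, add_zero]
    refine sum_congr rfl fun q _ => ?_
    rw [sum_range_succ', pairCount_zero_left, add_zero]
  rw [hext, sum_congr rfl fun j _ => hrow j]
  simp only [sum_add_distrib, sum_sub_distrib]
  rw [sum_range_sum_range_succ, sum_choose_mul_pow]
  have h1 := sum_choose_mul_pow_mul m (1 : ℤ)
  have h0 := sum_choose_mul_pow (m + 1) (1 : ℤ)
  simp only [one_pow, one_mul, mul_one] at h1 h0
  have h2 : ∑ i ∈ range (m + 2), (((m + 2 : ℕ) : ℤ) - i) * ((m + 1).choose i : ℤ) =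
      (m + 2) * (1 + 1) ^ (m + 1) - (m + 1) * (1 + 1) ^ m := by
    rw [← h0, ← h1, mul_sum, ← sum_sub_distrib]
    exact sum_congr rfl fun i _ => by push_cast; ring
  have h3 : ∑ i ∈ range (m + 2), (i : ℤ) = ((m + 2).choose 2 : ℤ) := by
    rw [← Nat.cast_sum, Finset.sum_range_id, Nat.choose_two_right]
  rw [h1, h2, h3]
  ring

theorem eulerianNum_two (m : ℕ) :
    (eulerianNum (m + 1) 2 : ℤ) =
      3 ^ (m + 1) - (m + 2) * 2 ^ (m + 1) + (m + 2).choose 2 := by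
  rw [← sum_pairCount]
  have := card_two_descents (n := m + 1) (fun _ => True) (fun _ _ => True) (by simp)
  simpa [eulerianNum] using this

theorem sum_pairCount_one (m : ℕ) :
    ∑ q ∈ range (m + 1), pairCount (m + 2) 1 (q + 1) =
      (m + 2) * 2 ^ (m + 1) - 2 ^ (m + 2) - (m + 2) * (m + 1) + 1 := by
  have h1 := sum_choose_mul_pow_mul (m + 1) (1 : ℤ)
  have h0 := sum_choose_mul_pow (m + 2) (1 : ℤ)
  simp only [one_pow, one_mul, mul_one] at h1 h0
  have h : ∑ j ∈ range (m + 3), pairCount (m + 2) 1 j =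
      (m + 2) * 2 ^ (m + 1) - (m + 2) * (m + 3) - 2 ^ (m + 2) + (m + 3) := by
    simp only [pairCount, sum_add_distrib, sum_sub_distrib, Nat.choose_one_right, h0, h1,
      sum_const, card_range, nsmul_eq_mul]
    push_cast
    ring
  rw [sum_range_succ, sum_range_succ', pairCount_self_right] at h
  have h00 : pairCount (m + 2) 1 0 = -(m + 2) := by simp [pairCount]
  rw [h00] at h
  linarith

theorem choose_two_mul_two (m : ℕ) :
    ((m + 2).choose 2 : ℤ) * 2 = (m + 2) * (m + 1) := by
  have := Nat.add_one_mul_choose_eq (m + 1) 1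
  rw [Nat.choose_one_right] at this
  push_cast [← Nat.cast_inj (R := ℤ)] at this
  linarith

theorem bCount_two (m : ℕ) :
    (bCount (m + 2) 2 : ℤ) = 3 ^ (m + 2) - 3 * (m + 2) * 2 ^ (m + 1)
      + 4 * (m + 2).choose 2 - 2 * (m + 2).choose 3 - 1 := by
  have hb := card_two_descents (n := m + 2) IsBallot (fun p q => 1 ≤ p ∧ 3 ≤ q)
    fun π p q => isBallot_iff_of_descentPositions_eq_pair
  have hrow : ∀ q, ∑ p ∈ range q,
      (if 1 ≤ p ∧ 3 ≤ q then pairCount (m + 2) (p + 1) (q + 1) else 0) =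
      ∑ p ∈ range q, pairCount (m + 2) (p + 1) (q + 1)
        - (if q = 0 then 0 else pairCount (m + 2) 1 (q + 1))
        - if q = 2 then pairCount (m + 2) 2 3 else 0 := by
    intro q
    match q with
    | 0 => simp
    | 1 => simp
    | 2 => simp [sum_range_succ]
    | q + 3 =>
      simp only [sum_range_succ' _ (q + 2)]
      simp
  change (bCount (m + 2) 2 : ℤ) = _ at hb
  rw [hb, sum_congr rfl fun q _ => hrow q, sum_sub_distrib, sum_sub_distrib]
  have h1 := sum_pairCount (m + 1)
  have h2 := sum_pairCount_one m
  have h3 : ∑ q ∈ range (m + 1), (if q = 0 then 0 else pairCount (m + 2) 1 (q + 1)) =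
      ∑ q ∈ range (m + 1), pairCount (m + 2) 1 (q + 1) - pairCount (m + 2) 1 1 := by
    rw [sum_range_succ', sum_range_succ' (fun q => pairCount (m + 2) 1 (q + 1))]
    simp
  have h4 : ∑ q ∈ range (m + 1), (if q = 2 then pairCount (m + 2) 2 3 else 0) =
      pairCount (m + 2) 2 3 := by
    rw [sum_ite_eq']
    split_ifs with h
    · rfl
    · rw [mem_range] at h
      obtain rfl | rfl : m = 0 ∨ m = 1 := by omega
      · rfl
      · rfl
  have h5 : pairCount (m + 2) 1 1 = -(m + 1) := by
    simp [pairCount]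
    ring
  have h6 : pairCount (m + 2) 2 3 = 2 * (m + 2).choose 3 - (m + 2).choose 2 + 1 := by
    simp only [pairCount, Nat.choose_succ_self_right]
    push_cast
    ring
  have c2 := choose_two_mul_two m
  have c3 : ((m + 1 + 2).choose 2 : ℤ) = (m + 2).choose 2 + (m + 2) := by
    rw [show m + 1 + 2 = (m + 2) + 1 by ring, Nat.choose_succ_succ' (m + 2) 1,
      Nat.choose_one_right]
    push_cast
    ring
  rw [show m + 2 - 1 = m + 1 by omega, h3, h4, h5, h6, h2, h1, c3]
  push_cast
  linear_combination -c2

section Drops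

variable {n : ℕ} {c : Equiv.Perm (Fin n)}

/-- The points that a permutation moves down. -/
noncomputable def drops (c : Equiv.Perm (Fin n)) : Finset (Fin n) :=
  {x ∈ c.support | c x < x}

/-- The points that a permutation moves up. -/
noncomputable def rises (c : Equiv.Perm (Fin n)) : Finset (Fin n) :=
  {x ∈ c.support | x < c x}

theorem mem_drops {x : Fin n} : x ∈ drops c ↔ c x < x := by
  simp only [drops, mem_filter, Equiv.Perm.mem_support, and_iff_right_iff_imp]
  exact fun h => h.ne

theorem mem_rises {x : Fin n} : x ∈ rises c ↔ x < c x := by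
  simp only [rises, mem_filter, Equiv.Perm.mem_support, and_iff_right_iff_imp]
  exact fun h => h.ne'

theorem card_drops_inv (c : Equiv.Perm (Fin n)) : #(drops c⁻¹) = #(rises c) := by
  have : drops c⁻¹ = (rises c).map c.toEmbedding := by
    ext x
    simp only [mem_drops, mem_map, mem_rises, Equiv.coe_toEmbedding]
    constructor
    · intro h
      exact ⟨c⁻¹ x, by simpa using h, by simp⟩
    · rintro ⟨y, h, rfl⟩
      simpa using h
  rw [this, card_map]

theorem card_rises_inv (c : Equiv.Perm (Fin n)) : #(rises c⁻¹) = #(drops c) := by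
  rw [← card_drops_inv, inv_inv]

theorem card_rises_add_card_drops (c : Equiv.Perm (Fin n)) :
    #(rises c) + #(drops c) = #c.support := by
  rw [← card_union_of_disjoint]
  · congr 1
    ext x
    simp only [mem_union, mem_rises, mem_drops, Equiv.Perm.mem_support]
    rw [ne_comm, ne_iff_lt_or_gt]
  · rw [disjoint_left]
    intro x h1 h2
    exact lt_asymm (mem_rises.1 h1) (mem_drops.1 h2)

theorem cycleM_eq (c : Equiv.Perm (Fin n)) : cycleM c = min #(rises c) #(drops c) := rfl

theorem max'_support_mem_drops (h : c.support.Nonempty) : c.support.max' h ∈ drops c := by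
  have hm := c.support.max'_mem h
  rw [mem_drops]
  refine lt_of_le_of_ne (le_max' _ _ (Equiv.Perm.apply_mem_support.2 hm)) ?_
  exact Equiv.Perm.mem_support.1 hm

theorem drops_nonempty (h : c ≠ 1) : (drops c).Nonempty :=
  ⟨_, max'_support_mem_drops (nonempty_iff_ne_empty.2 (by simpa using h))⟩

theorem cycleM_pos (h : c ≠ 1) : 1 ≤ cycleM c := by
  have h1 := card_pos.2 (drops_nonempty h)
  have h2 := card_pos.2 (drops_nonempty (inv_ne_one.2 h))
  rw [card_drops_inv] at h2
  rw [cycleM_eq]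
  omega

theorem mem_drops_formPerm {L : List (Fin n)} (hL : L.Nodup) (hlen : 2 ≤ L.length) {x : Fin n} :
    x ∈ drops L.formPerm ↔ ∃ (i : ℕ) (hi : i < L.length),
      x = L[i] ∧ L[(i + 1) % L.length]'(Nat.mod_lt _ (by omega)) < L[i] := by
  rw [mem_drops]
  constructor
  · intro h
    have hx : x ∈ L := by
      by_contra hx
      rw [List.formPerm_apply_of_notMem hx] at h
      exact lt_irrefl _ h
    obtain ⟨i, hi, rfl⟩ := List.mem_iff_getElem.1 hx
    rw [List.formPerm_apply_getElem _ hL] at h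
    exact ⟨i, hi, rfl, h⟩
  · rintro ⟨i, hi, rfl, h⟩
    rwa [List.formPerm_apply_getElem _ hL]

theorem ne_singleton_of_two_le_length {α : Type*} {L : List α} (h : 2 ≤ L.length) (x : α) :
    L ≠ [x] := by
  rintro rfl
  simp at h

/-- The cycle that runs through `A` and then through `B`, each in increasing order. -/
noncomputable def twoRunCycle (A B : Finset (Fin n)) : Equiv.Perm (Fin n) :=
  (A.sort (· ≤ ·) ++ B.sort (· ≤ ·)).formPerm

theorem nodup_sort_append_sort {A B : Finset (Fin n)} (h : Disjoint A B) :
    (A.sort (· ≤ ·) ++ B.sort (· ≤ ·)).Nodup := by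
  rw [List.nodup_append]
  refine ⟨A.sort_nodup _, B.sort_nodup _, fun a ha b hb => ?_⟩
  rw [mem_sort] at ha hb
  rintro rfl
  exact disjoint_left.1 h ha hb

theorem isCycle_twoRunCycle {A B : Finset (Fin n)} (h : Disjoint A B) (hcard : 2 ≤ #A + #B) :
    (twoRunCycle A B).IsCycle :=
  List.isCycle_formPerm (nodup_sort_append_sort h) (by simpa using hcard)

theorem support_twoRunCycle {A B : Finset (Fin n)} (h : Disjoint A B) (hcard : 2 ≤ #A + #B) :
    (twoRunCycle A B).support = A ∪ B := by
  rw [twoRunCycle, List.support_formPerm_of_nodup _ (nodup_sort_append_sort h)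
    (ne_singleton_of_two_le_length (by simpa using hcard)), List.toFinset_append,
    sort_toFinset, sort_toFinset]

theorem sort_getElem_lt {A : Finset (Fin n)} {i j : ℕ} (hij : i < j)
    (hj : j < (A.sort (· ≤ ·)).length) :
    (A.sort (· ≤ ·))[i] < (A.sort (· ≤ ·))[j] :=
  (sortedLT_sort A).getElem_lt_getElem_iff.2 hij

theorem sort_getElem_zero_lt_of_exists_lt {A B : Finset (Fin n)}
    (hinv : ∃ a ∈ A, ∃ b ∈ B, b < a) (hB : 0 < (B.sort (· ≤ ·)).length)
    (hA : #A - 1 < (A.sort (· ≤ ·)).length) :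
    (B.sort (· ≤ ·))[0] < (A.sort (· ≤ ·))[#A - 1] := by
  obtain ⟨a, ha, b, hb, hinv⟩ := hinv
  obtain ⟨i, hi, rfl⟩ := List.mem_iff_getElem.1 ((mem_sort (s := A) (· ≤ ·)).2 ha)
  obtain ⟨j, hj, rfl⟩ := List.mem_iff_getElem.1 ((mem_sort (s := B) (· ≤ ·)).2 hb)
  have hi' : i < #A := by simpa using hi
  exact ((sortedLT_sort B).getElem_le_getElem_iff.2 (Nat.zero_le j)).trans_lt
    (hinv.trans_le ((sortedLT_sort A).getElem_le_getElem_iff.2 (by omega)))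

theorem card_drops_twoRunCycle_empty {S : Finset (Fin n)} (hcard : 2 ≤ #S) :
    #(drops (twoRunCycle ∅ S)) = 1 := by
  have hlen : (S.sort (· ≤ ·)).length = #S := length_sort _
  have hform : twoRunCycle ∅ S = (S.sort (· ≤ ·)).formPerm := by simp [twoRunCycle]
  rw [card_eq_one]
  refine ⟨(S.sort (· ≤ ·))[#S - 1]'(by omega), ?_⟩
  ext x
  rw [hform, mem_drops_formPerm (S.sort_nodup _) (by omega), mem_singleton]
  constructor
  · rintro ⟨i, hi, rfl, h⟩
    by_cases h' : i + 1 < (S.sort (· ≤ ·)).length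
    · simp only [Nat.mod_eq_of_lt h'] at h
      exact absurd (sort_getElem_lt (Nat.lt_succ_self i) h') (lt_asymm h)
    · congr 1
      omega
  · rintro rfl
    refine ⟨#S - 1, by omega, rfl, ?_⟩
    have : (#S - 1 + 1) % (S.sort (· ≤ ·)).length = 0 := by
      rw [hlen, Nat.sub_add_cancel (by omega), Nat.mod_self]
    simp only [this]
    exact sort_getElem_lt (by omega) (by omega)

theorem card_drops_twoRunCycle {A B : Finset (Fin n)} (hdisj : Disjoint A B)
    (hmax : ∃ b ∈ B, ∀ a ∈ A, a < b) (hinv : ∃ a ∈ A, ∃ b ∈ B, b < a) :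
    #(drops (twoRunCycle A B)) = 2 := by
  obtain ⟨b₁, hb₁, hmax⟩ := hmax
  obtain ⟨a₂, ha₂, b₂, hb₂, hinv⟩ := hinv
  have hA : 0 < #A := card_pos.2 ⟨_, ha₂⟩
  have hB : 0 < #B := card_pos.2 ⟨_, hb₂⟩
  set LA := A.sort (· ≤ ·) with hLA
  set LB := B.sort (· ≤ ·) with hLB
  have hlA : LA.length = #A := length_sort _
  have hlB : LB.length = #B := length_sort _
  have hlen : (LA ++ LB).length = #A + #B := by simp [hlA, hlB]
  have hnd : (LA ++ LB).Nodup := nodup_sort_append_sort hdisj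
  have hlast : ∀ a ∈ A, a < LB[#B - 1]'(by omega) := by
    intro a ha
    refine (hmax a ha).trans_le ?_
    obtain ⟨i, hi, rfl⟩ := List.mem_iff_getElem.1 ((mem_sort (s := B) (· ≤ ·)).2 hb₁)
    have hi' : i < #B := by simpa using hi
    exact (sortedLT_sort B).getElem_le_getElem_iff.2 (by omega)
  have hmid : LB[0]'(by omega) < LA[#A - 1]'(by omega) :=
    sort_getElem_zero_lt_of_exists_lt ⟨a₂, ha₂, b₂, hb₂, hinv⟩ _ _
  have hgA : ∀ i (hi : i < #A), (LA ++ LB)[i]'(by omega) = LA[i]'(by omega) :=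
    fun i hi => List.getElem_append_left (by omega)
  have hgB : ∀ i (hi : i < #B), (LA ++ LB)[#A + i]'(by omega) = LB[i]'(by omega) := by
    intro i hi
    rw [List.getElem_append_right (by omega)]
    simp only [hlA, Nat.add_sub_cancel_left]
  rw [card_eq_two]
  refine ⟨LA[#A - 1]'(by omega), LB[#B - 1]'(by omega), ?_, ?_⟩
  · exact (hlast _ ((mem_sort (s := A) (· ≤ ·)).1 (List.getElem_mem _))).ne
  ext x
  change x ∈ drops (LA ++ LB).formPerm ↔ _
  rw [mem_drops_formPerm hnd (by omega), mem_insert, mem_singleton]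
  constructor
  · rintro ⟨i, hi, rfl, h⟩
    by_cases h1 : i + 1 < #A
    · simp only [Nat.mod_eq_of_lt (show i + 1 < (LA ++ LB).length by omega)] at h
      rw [hgA i (by omega), hgA (i + 1) h1] at h
      exact absurd (sort_getElem_lt (Nat.lt_succ_self i) (by rwa [length_sort])) (lt_asymm h)
    by_cases h2 : i + 1 = #A
    · left
      rw [hgA i (by omega)]
      congr 1
      omega
    obtain ⟨j, rfl⟩ : ∃ j, i = #A + j := ⟨i - #A, by omega⟩
    by_cases h3 : j + 1 < #B
    · have : (#A + j + 1) % (LA ++ LB).length = #A + (j + 1) := Nat.mod_eq_of_lt (by omega)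
      simp only [this] at h
      rw [hgB j (by omega), hgB (j + 1) h3] at h
      exact absurd (sort_getElem_lt (Nat.lt_succ_self j) (by rwa [length_sort])) (lt_asymm h)
    · right
      rw [hgB j (by omega)]
      congr 1
      omega
  · rintro (rfl | rfl)
    · refine ⟨#A - 1, by omega, (hgA _ (by omega)).symm, ?_⟩
      have : (#A - 1 + 1) % (LA ++ LB).length = #A + 0 := by
        rw [Nat.mod_eq_of_lt (by omega)]
        omega
      simp only [this]
      rw [hgB 0 hB, hgA (#A - 1) (by omega)]
      exact hmid
    · refine ⟨#A + (#B - 1), by omega, (hgB _ (by omega)).symm, ?_⟩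
      have : (#A + (#B - 1) + 1) % (LA ++ LB).length = 0 := by
        rw [hlen, show #A + (#B - 1) + 1 = #A + #B by omega, Nat.mod_self]
      simp only [this]
      rw [hgA 0 hA, hgB (#B - 1) (by omega)]
      exact hlast _ ((mem_sort (s := A) (· ≤ ·)).1 (List.getElem_mem _))

/-- The word of a cycle that ends in `m`. -/
theorem exists_word_of_isCycle (hc : c.IsCycle) {m : Fin n} (hm : m ∈ c.support) :
    ∃ (L : List (Fin n)) (_ : 2 ≤ L.length), L.Nodup ∧ L.formPerm = c ∧
      L.toFinset = c.support ∧ L[L.length - 1] = m := by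
  have hcm : c m ∈ c.support := Equiv.Perm.apply_mem_support.2 hm
  have hcyc : c.cycleOf (c m) = c := hc.cycleOf_eq (Equiv.Perm.mem_support.1 hcm)
  have hlen : (c.toList (c m)).length = #c.support := by rw [Equiv.Perm.length_toList, hcyc]
  have hlen2 : 2 ≤ #c.support := hc.two_le_card_support
  refine ⟨c.toList (c m), by omega, Equiv.Perm.nodup_toList _ _, ?_, ?_, ?_⟩
  · rw [Equiv.Perm.formPerm_toList, hcyc]
  · ext x
    rw [List.mem_toFinset, Equiv.Perm.mem_toList_iff]
    constructor
    · rintro ⟨h, -⟩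
      exact Equiv.Perm.mem_support.2 ((h.apply_eq_self_iff).not.1 (Equiv.Perm.mem_support.1 hcm))
    · intro h
      exact ⟨hc.sameCycle (Equiv.Perm.mem_support.1 hcm) (Equiv.Perm.mem_support.1 h), hcm⟩
  · rw [Equiv.Perm.getElem_toList, ← Equiv.Perm.mul_apply, ← pow_succ,
      Nat.sub_add_cancel (by omega), hlen, ← hc.orderOf, pow_orderOf_eq_one, Equiv.Perm.one_apply]

theorem lt_of_getElem_notMem_drops {L : List (Fin n)} (hL : L.Nodup) {i : ℕ}
    (hi : i + 1 < L.length) (h : L[i] ∉ drops L.formPerm) : L[i] < L[i + 1] := by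
  rw [mem_drops, List.formPerm_apply_lt_getElem _ hL _ hi, not_lt] at h
  refine lt_of_le_of_ne h fun he => ?_
  have := (hL.getElem_inj_iff).1 he
  omega

theorem sort_toFinset_of_isChain_lt {L : List (Fin n)} (h : L.IsChain (· < ·)) :
    L.toFinset.sort (· ≤ ·) = L := by
  have hp : L.Pairwise (· < ·) := List.isChain_iff_pairwise.1 h
  exact (List.toFinset_sort (· ≤ ·) (hp.imp fun h => ne_of_lt h)).2 (hp.imp fun h => le_of_lt h)

theorem eq_twoRunCycle_empty (hc : c.IsCycle) (hd : #(drops c) = 1) :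
    c = twoRunCycle ∅ c.support := by
  obtain ⟨m, hm⟩ := card_eq_one.1 hd
  have hmc : m ∈ c.support := (mem_filter.1 (hm ▸ mem_singleton_self m : m ∈ drops c)).1
  obtain ⟨L, hlen, hnd, hform, hfin, hlast⟩ := exists_word_of_isCycle hc hmc
  have hsort : L.toFinset.sort (· ≤ ·) = L := by
    refine sort_toFinset_of_isChain_lt (List.isChain_iff_getElem.2 fun i hi => ?_)
    refine lt_of_getElem_notMem_drops hnd hi ?_
    rw [hform, hm, mem_singleton, ← hlast, hnd.getElem_inj_iff]
    omega
  rw [← hfin, twoRunCycle, hsort]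
  simp [hform]

theorem exists_eq_twoRunCycle (hc : c.IsCycle) (hd : #(drops c) = 2)
    (hne : c.support.Nonempty) :
    ∃ A ⊆ c.support.erase (c.support.max' hne), (∃ a ∈ A, ∃ b ∈ c.support \ A, b < a) ∧
      c = twoRunCycle A (c.support \ A) := by
  set m := c.support.max' hne with hmdef
  have hmd : m ∈ drops c := max'_support_mem_drops hne
  have hmc : m ∈ c.support := (mem_filter.1 hmd).1
  obtain ⟨m', hm'⟩ : ∃ m', (drops c).erase m = {m'} := by
    rw [← card_eq_one, card_erase_of_mem hmd, hd]
  have hdrops : ∀ x ∈ drops c, x = m ∨ x = m' := by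
    intro x hx
    by_cases h : x = m
    · exact Or.inl h
    · exact Or.inr (mem_singleton.1 (hm' ▸ mem_erase.2 ⟨h, hx⟩))
  obtain ⟨hm'm, hm'd⟩ := mem_erase.1 (hm' ▸ mem_singleton_self m' : m' ∈ (drops c).erase m)
  obtain ⟨L, hlen, hnd, hform, hfin, hlast⟩ := exists_word_of_isCycle hc hmc
  have hm'L : m' ∈ L := by
    rw [← List.mem_toFinset, hfin]
    exact (mem_filter.1 hm'd).1
  obtain ⟨i, hi, him'⟩ := List.mem_iff_getElem.1 hm'L
  have hi' : i + 1 < L.length := by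
    by_contra h
    apply hm'm
    rw [← him', ← hlast]
    congr 1
    omega
  have hstep : ∀ j (hj : j + 1 < L.length), j ≠ i → L[j] < L[j + 1] := by
    intro j hj hji
    refine lt_of_getElem_notMem_drops hnd hj fun h => ?_
    rw [hform] at h
    rcases hdrops _ h with h | h
    · rw [← hlast, hnd.getElem_inj_iff] at h
      omega
    · rw [← him', hnd.getElem_inj_iff] at h
      exact hji h
  have hnd' : (L.take (i + 1) ++ L.drop (i + 1)).Nodup := by rwa [List.take_append_drop]
  have hdisj : Disjoint (L.take (i + 1)).toFinset (L.drop (i + 1)).toFinset := by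
    rw [List.disjoint_toFinset_iff_disjoint]
    exact List.disjoint_of_nodup_append hnd'
  have hunion : (L.take (i + 1)).toFinset ∪ (L.drop (i + 1)).toFinset = c.support := by
    rw [← List.toFinset_append, List.take_append_drop, hfin]
  have hsdiff : c.support \ (L.take (i + 1)).toFinset = (L.drop (i + 1)).toFinset := by
    rw [← hunion, union_sdiff_cancel_left hdisj]
  have hdropmem : ∀ j (hj : j < L.length), i + 1 ≤ j → L[j] ∈ (L.drop (i + 1)).toFinset := by
    intro j hj hij
    rw [List.mem_toFinset, List.mem_iff_getElem]
    refine ⟨j - (i + 1), by simp; omega, ?_⟩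
    rw [List.getElem_drop]
    congr 1
    omega
  refine ⟨(L.take (i + 1)).toFinset, ?_, ?_, ?_⟩
  · intro x hx
    refine mem_erase.2 ⟨?_, hunion ▸ mem_union_left _ hx⟩
    rintro rfl
    refine disjoint_left.1 hdisj hx ?_
    have := hdropmem (L.length - 1) (by omega) (by omega)
    rwa [hlast] at this
  · refine ⟨m', ?_, L[i + 1], ?_, ?_⟩
    · rw [List.mem_toFinset, List.mem_iff_getElem]
      refine ⟨i, by simp; omega, ?_⟩
      rw [List.getElem_take, him']
    · rw [hsdiff]
      exact hdropmem _ hi' le_rfl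
    · have := mem_drops.1 hm'd
      rw [← him', ← hform, List.formPerm_apply_lt_getElem _ hnd _ hi'] at this
      rwa [← him']
  · rw [hsdiff, twoRunCycle, sort_toFinset_of_isChain_lt, sort_toFinset_of_isChain_lt,
      List.take_append_drop, hform]
    · refine List.isChain_iff_getElem.2 fun j hj => ?_
      simp only [List.length_drop] at hj
      simp only [List.getElem_drop]
      exact hstep (i + 1 + j) (by omega) (by omega)
    · refine List.isChain_iff_getElem.2 fun j hj => ?_
      simp only [List.length_take] at hj
      simp only [List.getElem_take]
      exact hstep j (by omega) (by omega)

theorem twoRunCycle_apply_max {A B : Finset (Fin n)} (hdisj : Disjoint A B) {m : Fin n}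
    (hm : m ∈ B) (hmax : ∀ b ∈ B, b ≤ m)
    (hlen : 0 < (A.sort (· ≤ ·) ++ B.sort (· ≤ ·)).length) :
    twoRunCycle A B m = (A.sort (· ≤ ·) ++ B.sort (· ≤ ·))[0] := by
  obtain ⟨j, hj, hjm⟩ := List.mem_iff_getElem.1 ((mem_sort (s := B) (· ≤ ·)).2 hm)
  have hlB : (B.sort (· ≤ ·)).length = #B := length_sort _
  have hlA : (A.sort (· ≤ ·)).length = #A := length_sort _
  have hj' : j = #B - 1 := by
    have h := hmax ((B.sort (· ≤ ·))[#B - 1]'(by omega))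
      ((mem_sort (s := B) (· ≤ ·)).1 (List.getElem_mem _))
    rw [← hjm] at h
    have := (sortedLT_sort B).getElem_le_getElem_iff.1 h
    omega
  have hidx : (A.sort (· ≤ ·) ++ B.sort (· ≤ ·))[#A + j]'(by simp; omega) = m := by
    rw [List.getElem_append_right (by omega), ← hjm]
    simp only [hlA, Nat.add_sub_cancel_left]
  rw [twoRunCycle]
  conv_lhs => rw [← hidx]
  rw [List.formPerm_apply_getElem _ (nodup_sort_append_sort hdisj)]
  have : (#A + j + 1) % (A.sort (· ≤ ·) ++ B.sort (· ≤ ·)).length = 0 := by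
    rw [List.length_append, hlA, hlB, show #A + j + 1 = #A + #B by omega, Nat.mod_self]
  simp only [this]

theorem card_le_of_sort_append_sort_eq {A B A' B' : Finset (Fin n)}
    (hinv : ∃ a ∈ A, ∃ b ∈ B, b < a)
    (h : A.sort (· ≤ ·) ++ B.sort (· ≤ ·) = A'.sort (· ≤ ·) ++ B'.sort (· ≤ ·)) :
    #A' ≤ #A := by
  by_contra! hlt
  have hlB : (B.sort (· ≤ ·)).length = #B := length_sort _
  have hlA : (A.sort (· ≤ ·)).length = #A := length_sort _
  have hlA' : (A'.sort (· ≤ ·)).length = #A' := length_sort _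
  obtain ⟨a, ha, b, hb, hba⟩ := id hinv
  have hA : 0 < #A := card_pos.2 ⟨_, ha⟩
  have hB : 0 < #B := card_pos.2 ⟨_, hb⟩
  have hmid := sort_getElem_zero_lt_of_exists_lt hinv (by omega) (by omega)
  have e1 : (A.sort (· ≤ ·) ++ B.sort (· ≤ ·))[#A - 1]'(by rw [List.length_append]; omega) =
      (A.sort (· ≤ ·))[#A - 1]'(by omega) := List.getElem_append_left (by omega)
  have e2 : (A.sort (· ≤ ·) ++ B.sort (· ≤ ·))[#A]'(by rw [List.length_append]; omega) =
      (B.sort (· ≤ ·))[0]'(by omega) := by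
    rw [List.getElem_append_right (by omega)]
    simp only [hlA, Nat.sub_self]
  have f1 : (A'.sort (· ≤ ·) ++ B'.sort (· ≤ ·))[#A - 1]'(by rw [List.length_append]; omega) =
      (A'.sort (· ≤ ·))[#A - 1]'(by omega) := List.getElem_append_left (by omega)
  have f2 : (A'.sort (· ≤ ·) ++ B'.sort (· ≤ ·))[#A]'(by rw [List.length_append]; omega) =
      (A'.sort (· ≤ ·))[#A]'(by omega) := List.getElem_append_left (by omega)
  have hlt' := sort_getElem_lt (A := A') (i := #A - 1) (j := #A) (by omega) (by omega)
  rw [← f1, ← f2] at hlt'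
  rw [← e1, ← e2] at hmid
  simp only [h] at hmid
  exact lt_asymm hlt' hmid

theorem twoRunCycle_injOn {S : Finset (Fin n)} (hS : S.Nonempty) {A A' : Finset (Fin n)}
    (hA : A ⊆ S.erase (S.max' hS)) (hA' : A' ⊆ S.erase (S.max' hS))
    (hinv : ∃ a ∈ A, ∃ b ∈ S \ A, b < a) (hinv' : ∃ a ∈ A', ∃ b ∈ S \ A', b < a)
    (h : twoRunCycle A (S \ A) = twoRunCycle A' (S \ A')) : A = A' := by
  have key : ∀ A : Finset (Fin n), A ⊆ S.erase (S.max' hS) → (∃ a ∈ A, ∃ b ∈ S \ A, b < a) →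
      A.sort (· ≤ ·) ++ (S \ A).sort (· ≤ ·) =
        (twoRunCycle A (S \ A)).toList (twoRunCycle A (S \ A) (S.max' hS)) := by
    intro A hA hinv
    obtain ⟨a, ha, b, hb, -⟩ := hinv
    have h1 : 0 < #A := card_pos.2 ⟨_, ha⟩
    have h2 : 0 < #(S \ A) := card_pos.2 ⟨_, hb⟩
    have hlen : 2 ≤ (A.sort (· ≤ ·) ++ (S \ A).sort (· ≤ ·)).length := by simp; omega
    rw [twoRunCycle_apply_max disjoint_sdiff (m := S.max' hS) ?_ ?_ (by omega)]
    · exact (Equiv.Perm.toList_formPerm_nontrivial _ hlen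
        (nodup_sort_append_sort disjoint_sdiff)).symm
    · exact mem_sdiff.2 ⟨S.max'_mem hS, fun h => (mem_erase.1 (hA h)).1 rfl⟩
    · exact fun b hb => S.le_max' _ (mem_sdiff.1 hb).1
  have hL : A.sort (· ≤ ·) ++ (S \ A).sort (· ≤ ·) =
      A'.sort (· ≤ ·) ++ (S \ A').sort (· ≤ ·) := by
    rw [key A hA hinv, key A' hA' hinv', h]
  have hcard : #A = #A' := le_antisymm (card_le_of_sort_append_sort_eq hinv' hL.symm)
    (card_le_of_sort_append_sort_eq hinv hL)
  have := (List.append_inj hL (by simpa using hcard)).1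
  rw [← A.sort_toFinset (· ≤ ·), this, sort_toFinset]

theorem card_cycles_one_drop {S : Finset (Fin n)} (hS : 2 ≤ #S) :
    #{c : Equiv.Perm (Fin n) | c.IsCycle ∧ c.support = S ∧ #(drops c) = 1} = 1 := by
  rw [card_eq_one]
  refine ⟨twoRunCycle ∅ S, ?_⟩
  ext c
  simp only [mem_filter, mem_univ, true_and, mem_singleton]
  constructor
  · rintro ⟨hc, rfl, hd⟩
    exact eq_twoRunCycle_empty hc hd
  · rintro rfl
    refine ⟨isCycle_twoRunCycle (disjoint_empty_left _) (by simpa using hS), ?_,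
      card_drops_twoRunCycle_empty hS⟩
    rw [support_twoRunCycle (disjoint_empty_left _) (by simpa using hS), empty_union]

theorem card_subsets_without_inversion {S : Finset (Fin n)} (hS : S.Nonempty) :
    #{A ∈ (S.erase (S.max' hS)).powerset | ¬ ∃ a ∈ A, ∃ b ∈ S \ A, b < a} = #S := by
  symm
  refine card_bij (fun x _ => {y ∈ S | y < x}) ?_ ?_ ?_
  · intro x hx
    simp only [mem_filter, mem_powerset, mem_sdiff]
    refine ⟨fun y hy => ?_, ?_⟩
    · obtain ⟨hyS, hyx⟩ := mem_filter.1 hy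
      exact mem_erase.2 ⟨(hyx.trans_le (S.le_max' _ hx)).ne, hyS⟩
    · rintro ⟨a, ⟨-, hax⟩, b, ⟨hbS, hb⟩, hba⟩
      exact hb ⟨hbS, hba.trans hax⟩
  · intro x hx y hy h
    by_contra hne
    rcases lt_or_gt_of_ne hne with hlt | hlt
    · have : x ∈ ({z ∈ S | z < y} : Finset _) := mem_filter.2 ⟨hx, hlt⟩
      rw [← h] at this
      exact lt_irrefl _ (mem_filter.1 this).2
    · have : y ∈ ({z ∈ S | z < x} : Finset _) := mem_filter.2 ⟨hy, hlt⟩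
      rw [h] at this
      exact lt_irrefl _ (mem_filter.1 this).2
  · intro A hA
    obtain ⟨hAS, hA⟩ := mem_filter.1 hA
    rw [mem_powerset] at hAS
    push Not at hA
    have hne : (S \ A).Nonempty :=
      ⟨_, mem_sdiff.2 ⟨S.max'_mem hS, fun h => (mem_erase.1 (hAS h)).1 rfl⟩⟩
    have hmin := mem_sdiff.1 ((S \ A).min'_mem hne)
    refine ⟨(S \ A).min' hne, hmin.1, ?_⟩
    ext y
    simp only [mem_filter]
    constructor
    · rintro ⟨hyS, hy⟩
      by_contra hyA
      exact absurd ((S \ A).min'_le _ (mem_sdiff.2 ⟨hyS, hyA⟩)) (not_le.2 hy)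
    · intro hy
      refine ⟨(mem_erase.1 (hAS hy)).2, lt_of_le_of_ne (hA y hy _ ((S \ A).min'_mem hne)) ?_⟩
      rintro rfl
      exact hmin.2 hy

theorem card_cycles_two_drops {S : Finset (Fin n)} (hS : S.Nonempty) :
    #{c : Equiv.Perm (Fin n) | c.IsCycle ∧ c.support = S ∧ #(drops c) = 2} + #S =
      2 ^ (#S - 1) := by
  have hbij : #{A ∈ (S.erase (S.max' hS)).powerset | ∃ a ∈ A, ∃ b ∈ S \ A, b < a} =
      #{c : Equiv.Perm (Fin n) | c.IsCycle ∧ c.support = S ∧ #(drops c) = 2} := by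
    refine card_bij (fun A _ => twoRunCycle A (S \ A)) ?_ ?_ ?_
    · intro A hA
      obtain ⟨hAS, hinv⟩ := mem_filter.1 hA
      rw [mem_powerset] at hAS
      have hcard : 2 ≤ #A + #(S \ A) := by
        obtain ⟨a, ha, b, hb, -⟩ := hinv
        have h1 : 0 < #A := card_pos.2 ⟨_, ha⟩
        have h2 : 0 < #(S \ A) := card_pos.2 ⟨_, hb⟩
        omega
      refine mem_filter.2 ⟨mem_univ _, isCycle_twoRunCycle disjoint_sdiff hcard, ?_, ?_⟩
      · rw [support_twoRunCycle disjoint_sdiff hcard,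
          union_sdiff_of_subset (hAS.trans (erase_subset _ _))]
      · refine card_drops_twoRunCycle disjoint_sdiff ⟨S.max' hS, ?_, fun a ha => ?_⟩ hinv
        · exact mem_sdiff.2 ⟨S.max'_mem hS, fun h => (mem_erase.1 (hAS h)).1 rfl⟩
        · obtain ⟨h1, h2⟩ := mem_erase.1 (hAS ha)
          exact lt_of_le_of_ne (S.le_max' _ h2) h1
    · intro A hA A' hA' h
      obtain ⟨hAS, hinv⟩ := mem_filter.1 hA
      obtain ⟨hAS', hinv'⟩ := mem_filter.1 hA'
      exact twoRunCycle_injOn hS (mem_powerset.1 hAS) (mem_powerset.1 hAS') hinv hinv' h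
    · intro c hmem
      obtain ⟨-, hc, rfl, hd⟩ := mem_filter.1 hmem
      obtain ⟨A, hA, hinv, hcA⟩ := exists_eq_twoRunCycle hc hd hS
      exact ⟨A, mem_filter.2 ⟨mem_powerset.2 hA, hinv⟩, hcA.symm⟩
  rw [← hbij, ← card_subsets_without_inversion hS, card_filter_add_card_filter_not,
    card_powerset, card_erase_of_mem (S.max'_mem hS), card_subsets_without_inversion hS]

theorem card_cycles_rises_eq (S : Finset (Fin n)) (d : ℕ) :
    #{c : Equiv.Perm (Fin n) | c.IsCycle ∧ c.support = S ∧ #(rises c) = d} =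
      #{c : Equiv.Perm (Fin n) | c.IsCycle ∧ c.support = S ∧ #(drops c) = d} := by
  refine card_bij (fun c _ => c⁻¹) ?_ ?_ ?_
  · intro c hc
    obtain ⟨-, h1, h2, h3⟩ := mem_filter.1 hc
    exact mem_filter.2 ⟨mem_univ _, h1.inv, by rwa [Equiv.Perm.support_inv],
      by rwa [card_drops_inv]⟩
  · exact fun _ _ _ _ h => inv_injective h
  · intro c hc
    obtain ⟨-, h1, h2, h3⟩ := mem_filter.1 hc
    exact ⟨c⁻¹, mem_filter.2 ⟨mem_univ _, h1.inv, by rwa [Equiv.Perm.support_inv],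
      by rwa [card_rises_inv]⟩, inv_inv c⟩

theorem card_cycles_cycleM_eq {S : Finset (Fin n)} {d : ℕ} (hS : 2 * d < #S) :
    #{c : Equiv.Perm (Fin n) | c.IsCycle ∧ c.support = S ∧ cycleM c = d} =
      2 * #{c : Equiv.Perm (Fin n) | c.IsCycle ∧ c.support = S ∧ #(drops c) = d} := by
  rw [two_mul]
  nth_rewrite 1 [← card_cycles_rises_eq]
  rw [← card_union_of_disjoint, ← filter_or]
  · congr 1
    ext c
    simp only [mem_filter, mem_univ, true_and]
    rw [cycleM_eq]
    have := card_rises_add_card_drops c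
    constructor
    · rintro ⟨h1, rfl, h3⟩
      rcases le_total #(rises c) #(drops c) with h | h
      · exact Or.inl ⟨h1, rfl, by omega⟩
      · exact Or.inr ⟨h1, rfl, by omega⟩
    · rintro (⟨h1, rfl, h3⟩ | ⟨h1, rfl, h3⟩)
      · exact ⟨h1, rfl, by omega⟩
      · exact ⟨h1, rfl, by omega⟩
  · rw [disjoint_filter]
    rintro c - ⟨-, rfl, h1⟩ ⟨-, -, h2⟩
    have := card_rises_add_card_drops c
    omega

theorem two_mul_cycleM_le (c : Equiv.Perm (Fin n)) : 2 * cycleM c ≤ #c.support := by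
  have := card_rises_add_card_drops c
  rw [cycleM_eq]
  omega

/-- The cycles of odd length with a given value of `M`. -/
noncomputable def oddCycles (n d : ℕ) : Finset (Equiv.Perm (Fin n)) :=
  {c | c.IsCycle ∧ Odd #c.support ∧ cycleM c = d}

theorem card_oddCycles_support_eq (S : Finset (Fin n)) (d : ℕ) :
    #{c ∈ oddCycles n d | c.support = S} = if Odd #S ∧ 2 * d < #S then
      2 * #{c : Equiv.Perm (Fin n) | c.IsCycle ∧ c.support = S ∧ #(drops c) = d} else 0 := by
  split_ifs with h
  · rw [← card_cycles_cycleM_eq h.2, oddCycles, filter_filter]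
    congr 1
    ext c
    simp only [mem_filter, mem_univ, true_and]
    constructor
    · rintro ⟨⟨h1, h2, h3⟩, h4⟩
      exact ⟨h1, h4, h3⟩
    · rintro ⟨h1, rfl, h3⟩
      exact ⟨⟨h1, h.1, h3⟩, rfl⟩
  · rw [card_eq_zero, filter_eq_empty_iff]
    intro c hc hS
    obtain ⟨-, h1, h2, h3⟩ := mem_filter.1 hc
    have := two_mul_cycleM_le c
    rw [hS] at h2 this
    refine h ⟨h2, ?_⟩
    obtain ⟨k, hk⟩ := h2
    omega

theorem card_oddCycles_one_support_eq (S : Finset (Fin n)) :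
    #{c ∈ oddCycles n 1 | c.support = S} = if Odd #S ∧ 3 ≤ #S then 2 else 0 := by
  rw [card_oddCycles_support_eq]
  by_cases h : Odd #S ∧ 3 ≤ #S
  · rw [if_pos ⟨h.1, by omega⟩, if_pos h, card_cycles_one_drop (by omega)]
  · rw [if_neg h, if_neg fun h' => h ⟨h'.1, by omega⟩]

theorem card_oddCycles_two_support_eq (S : Finset (Fin n)) :
    (#{c ∈ oddCycles n 2 | c.support = S} : ℤ) =
      if Odd #S ∧ 5 ≤ #S then (2 : ℤ) ^ #S - 2 * #S else 0 := by
  rw [card_oddCycles_support_eq]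
  by_cases h : Odd #S ∧ 5 ≤ #S
  · rw [if_pos ⟨h.1, by omega⟩, if_pos h]
    have h1 := card_cycles_two_drops (S := S) (card_pos.1 (by omega))
    have h2 : 2 ^ #S = 2 * 2 ^ (#S - 1) := by rw [← pow_succ', Nat.sub_add_cancel (by omega)]
    have h3 : (2 : ℤ) ^ #S = 2 * ((2 ^ (#S - 1) : ℕ) : ℤ) := by exact_mod_cast h2
    rw [h3, ← h1]
    push_cast
    ring
  · rw [if_neg h, if_neg fun h' => h ⟨h'.1, by omega⟩]
    rfl

/-- The ordered pairs of disjoint odd cycles with `M = 1`. -/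
noncomputable def oddCyclePairs (n : ℕ) : Finset (Equiv.Perm (Fin n) × Equiv.Perm (Fin n)) :=
  {x ∈ oddCycles n 1 ×ˢ oddCycles n 1 | x.1.Disjoint x.2}

theorem cycleFactorsFinset_mul_of_mem_oddCyclePairs
    {x : Equiv.Perm (Fin n) × Equiv.Perm (Fin n)} (hx : x ∈ oddCyclePairs n) :
    (x.1 * x.2).cycleFactorsFinset = {x.1, x.2} ∧ x.1 ≠ x.2 := by
  obtain ⟨h12, hd⟩ := mem_filter.1 hx
  obtain ⟨h1, h2⟩ := mem_product.1 h12
  have c1 := (mem_filter.1 h1).2.1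
  have c2 := (mem_filter.1 h2).2.1
  constructor
  · rw [hd.cycleFactorsFinset_mul_eq_union, Equiv.Perm.cycleFactorsFinset_eq_singleton_self_iff.2 c1,
      Equiv.Perm.cycleFactorsFinset_eq_singleton_self_iff.2 c2]
    rfl
  · intro h
    rw [h, Equiv.Perm.disjoint_refl_iff] at hd
    exact c2.ne_one hd

theorem odd_lcm {a b : ℕ} : Odd (a.lcm b) ↔ Odd a ∧ Odd b := by
  constructor
  · intro h
    exact ⟨h.of_dvd_nat (Nat.dvd_lcm_left a b), h.of_dvd_nat (Nat.dvd_lcm_right a b)⟩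
  · rintro ⟨h1, h2⟩
    exact (h1.mul h2).of_dvd_nat (Nat.lcm_dvd_mul a b)

theorem odd_order_permM_two_iff (π : Equiv.Perm (Fin n)) :
    (Odd (orderOf π) ∧ permM π = 2) ↔
      π ∈ oddCycles n 2 ∨ π ∈ (oddCyclePairs n).image fun x => x.1 * x.2 := by
  constructor
  · rintro ⟨hodd, hM⟩
    have hcyc : ∀ c ∈ π.cycleFactorsFinset, c.IsCycle := fun c hc =>
      (Equiv.Perm.mem_cycleFactorsFinset_iff.1 hc).1
    have hpos : ∀ c ∈ π.cycleFactorsFinset, 1 ≤ cycleM c := fun c hc =>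
      cycleM_pos (hcyc c hc).ne_one
    have hle : #π.cycleFactorsFinset ≤ 2 := by
      rw [← hM, permM, card_eq_sum_ones]
      exact sum_le_sum hpos
    interval_cases hk : #π.cycleFactorsFinset
    · rw [card_eq_zero] at hk
      simp [permM, hk] at hM
    · obtain ⟨c, hc⟩ := card_eq_one.1 hk
      obtain ⟨h1, rfl⟩ := Equiv.Perm.cycleFactorsFinset_eq_singleton_iff.1 hc
      rw [permM, hc, sum_singleton] at hM
      rw [h1.orderOf] at hodd
      exact Or.inl (mem_filter.2 ⟨mem_univ _, h1, hodd, hM⟩)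
    · right
      obtain ⟨c, d, hcd, hset⟩ := card_eq_two.1 hk
      have hc : c ∈ π.cycleFactorsFinset := by rw [hset]; simp
      have hd : d ∈ π.cycleFactorsFinset := by rw [hset]; simp
      have hdisj : c.Disjoint d := π.cycleFactorsFinset_pairwise_disjoint hc hd hcd
      have hprod : c * d = π := by
        obtain ⟨-, h, hp⟩ := Equiv.Perm.cycleFactorsFinset_eq_finset.1 hset
        rw [← hp, noncommProd_insert_of_notMem _ _ _ _ (by simpa using hcd),
          noncommProd_singleton]
        rfl
      rw [permM, hset, sum_pair hcd] at hM
      rw [← hprod, hdisj.orderOf, odd_lcm, (hcyc c hc).orderOf, (hcyc d hd).orderOf] at hodd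
      have h1 := hpos c hc
      have h2 := hpos d hd
      refine mem_image.2 ⟨(c, d), mem_filter.2 ⟨mem_product.2 ⟨?_, ?_⟩, hdisj⟩, hprod⟩
      · exact mem_filter.2 ⟨mem_univ _, hcyc c hc, hodd.1, show cycleM c = 1 by omega⟩
      · exact mem_filter.2 ⟨mem_univ _, hcyc d hd, hodd.2, show cycleM d = 1 by omega⟩
  · rintro (h | h)
    · obtain ⟨-, h1, h2, h3⟩ := mem_filter.1 h
      rw [h1.orderOf, permM, Equiv.Perm.cycleFactorsFinset_eq_singleton_self_iff.2 h1,
        sum_singleton]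
      exact ⟨h2, h3⟩
    · obtain ⟨⟨c, d⟩, hx, rfl⟩ := mem_image.1 h
      obtain ⟨hset, hne⟩ := cycleFactorsFinset_mul_of_mem_oddCyclePairs hx
      obtain ⟨h12, hdisj⟩ := mem_filter.1 hx
      obtain ⟨hc, hd⟩ := mem_product.1 h12
      obtain ⟨-, c1, c2, c3⟩ := mem_filter.1 hc
      obtain ⟨-, d1, d2, d3⟩ := mem_filter.1 hd
      dsimp only at *
      rw [permM, hset, sum_pair hne, c3, d3, hdisj.orderOf, odd_lcm, c1.orderOf, d1.orderOf]
      exact ⟨⟨c2, d2⟩, rfl⟩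

theorem card_oddCyclePairs_eq :
    #(oddCyclePairs n) = 2 * #((oddCyclePairs n).image fun x => x.1 * x.2) := by
  rw [card_eq_sum_card_image fun x : Equiv.Perm (Fin n) × Equiv.Perm (Fin n) => x.1 * x.2,
    mul_comm, ← smul_eq_mul, ← sum_const]
  refine sum_congr rfl fun π hπ => ?_
  obtain ⟨⟨c, d⟩, hx, rfl⟩ := mem_image.1 hπ
  obtain ⟨hset, hne⟩ := cycleFactorsFinset_mul_of_mem_oddCyclePairs hx
  obtain ⟨h12, hdisj⟩ := mem_filter.1 hx
  obtain ⟨hc, hd⟩ := mem_product.1 h12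
  dsimp only at *
  have : ({x ∈ oddCyclePairs n | x.1 * x.2 = c * d} : Finset _) = {(c, d), (d, c)} := by
    ext ⟨a, b⟩
    simp only [mem_filter, mem_insert, mem_singleton, Prod.mk.injEq]
    constructor
    · rintro ⟨hab, he⟩
      obtain ⟨hset', hne'⟩ := cycleFactorsFinset_mul_of_mem_oddCyclePairs hab
      dsimp only at *
      rw [he, hset] at hset'
      have ha : a ∈ ({c, d} : Finset _) := by rw [hset']; simp
      have hb : b ∈ ({c, d} : Finset _) := by rw [hset']; simp
      simp only [mem_insert, mem_singleton] at ha hb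
      rcases ha with rfl | rfl <;> rcases hb with rfl | rfl <;> simp_all
    · rintro (⟨rfl, rfl⟩ | ⟨rfl, rfl⟩)
      · exact ⟨hx, rfl⟩
      · exact ⟨mem_filter.2 ⟨mem_product.2 ⟨hd, hc⟩, hdisj.symm⟩, hdisj.symm.commute.eq⟩
  rw [this, card_pair]
  simp [hne]

theorem pCount_two_eq :
    2 * pCount n 2 = 2 * #(oddCycles n 2) + #(oddCyclePairs n) := by
  rw [card_oddCyclePairs_eq, ← mul_add, ← card_union_of_disjoint]
  · unfold pCount
    refine congrArg (fun s : Finset (Equiv.Perm (Fin n)) => 2 * #s) ?_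
    ext π
    rw [mem_union, ← odd_order_permM_two_iff]
    simp
  · rw [disjoint_left]
    intro π h1 h2
    obtain ⟨x, hx, rfl⟩ := mem_image.1 h2
    obtain ⟨hset, hne⟩ := cycleFactorsFinset_mul_of_mem_oddCyclePairs hx
    rw [Equiv.Perm.cycleFactorsFinset_eq_singleton_self_iff.2 (mem_filter.1 h1).2.1] at hset
    have := congrArg card hset
    rw [card_pair hne, card_singleton] at this
    omega

end Drops

theorem card_oddCycles_two (n : ℕ) :
    (#(oddCycles n 2) : ℤ) = ∑ k ∈ range (n + 1),
      n.choose k * if Odd k ∧ 5 ≤ k then (2 : ℤ) ^ k - 2 * k else 0 := by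
  rw [card_eq_sum_card_fiberwise (f := fun c => c.support) (t := univ.powerset)
    fun c _ => by simp]
  push_cast
  simp only [card_oddCycles_two_support_eq]
  rw [sum_powerset_apply_card fun k => if Odd k ∧ 5 ≤ k then (2 : ℤ) ^ k - 2 * k else 0]
  simp

theorem card_oddCyclePairs (n : ℕ) :
    (#(oddCyclePairs n) : ℤ) = ∑ k ∈ range (n + 1), n.choose k *
      ((if Odd k ∧ 3 ≤ k then 2 else 0) * ∑ j ∈ range (n - k + 1),
        ((n - k).choose j : ℤ) * if Odd j ∧ 3 ≤ j then 2 else 0) := by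
  have hfib : ∀ A B : Finset (Fin n),
      #{x ∈ oddCyclePairs n | (x.1.support, x.2.support) = (A, B)} =
        if B ∈ Aᶜ.powerset then #{c ∈ oddCycles n 1 | c.support = A} *
          #{c ∈ oddCycles n 1 | c.support = B} else 0 := by
    intro A B
    have hBA : B ∈ Aᶜ.powerset ↔ Disjoint A B := by
      rw [mem_powerset, subset_compl_iff_disjoint_right, disjoint_comm]
    rw [← card_product]
    split_ifs with h
    · congr 1
      ext ⟨c, d⟩
      simp only [oddCyclePairs, mem_filter, mem_product, Prod.mk.injEq,
        Equiv.Perm.disjoint_iff_disjoint_support]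
      constructor
      · rintro ⟨⟨⟨h1, h2⟩, -⟩, h3, h4⟩
        exact ⟨⟨h1, h3⟩, h2, h4⟩
      · rintro ⟨⟨h1, rfl⟩, h2, rfl⟩
        exact ⟨⟨⟨h1, h2⟩, hBA.1 h⟩, rfl, rfl⟩
    · rw [card_eq_zero, filter_eq_empty_iff]
      rintro ⟨c, d⟩ hx he
      simp only [Prod.mk.injEq] at he
      obtain ⟨rfl, rfl⟩ := he
      exact h (hBA.2 (Equiv.Perm.disjoint_iff_disjoint_support.1 (mem_filter.1 hx).2))
  rw [card_eq_sum_card_fiberwise (f := fun x => (x.1.support, x.2.support))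
    (t := univ ×ˢ univ) fun c _ => by simp, sum_product]
  simp only [hfib, sum_ite_mem, univ_inter, ← mul_sum, card_oddCycles_one_support_eq]
  have hinner : ∀ A : Finset (Fin n),
      ∑ B ∈ Aᶜ.powerset, (if Odd #B ∧ 3 ≤ #B then 2 else 0) =
        ∑ j ∈ range (n - #A + 1), (n - #A).choose j * if Odd j ∧ 3 ≤ j then 2 else 0 := by
    intro A
    rw [sum_powerset_apply_card fun k => if Odd k ∧ 3 ≤ k then 2 else 0, card_compl,
      Fintype.card_fin]
    simp only [smul_eq_mul]
  simp only [hinner]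
  rw [← powerset_univ, sum_powerset_apply_card fun k => (if Odd k ∧ 3 ≤ k then 2 else 0) *
    ∑ j ∈ range (n - k + 1), (n - k).choose j * if Odd j ∧ 3 ≤ j then 2 else 0]
  simp only [card_univ, Fintype.card_fin, smul_eq_mul]
  push_cast
  rfl

theorem two_mul_odd_weight (k : ℕ) :
    (if Odd k ∧ 3 ≤ k then 2 else 0 : ℤ) = 1 - (-1) ^ k - if k = 1 then 2 else 0 := by
  rcases Nat.even_or_odd k with h | h
  · have : k ≠ 1 := by rintro rfl; simp at h
    simp [h.neg_one_pow, Nat.not_odd_iff_even.2 h, this]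
  · rcases eq_or_ne k 1 with rfl | h1
    · simp
    · obtain ⟨j, rfl⟩ := h
      rw [if_pos ⟨⟨j, rfl⟩, by omega⟩, if_neg h1, Odd.neg_one_pow ⟨j, rfl⟩]
      norm_num

theorem sum_choose_mul_ite_eq {n r : ℕ} (f : ℕ → ℤ) (hr : n < r → f r = 0 ∨ n.choose r = 0) :
    ∑ k ∈ range (n + 1), (n.choose k : ℤ) * (if k = r then f k else 0) = n.choose r * f r := by
  simp only [mul_ite, mul_zero, sum_ite_eq', mem_range]
  split_ifs with h
  · rfl
  · rcases hr (by omega) with h | h <;> simp [h]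

theorem sum_odd_weight (m : ℕ) :
    ∑ j ∈ range (m + 1), (m.choose j : ℤ) * (if Odd j ∧ 3 ≤ j then 2 else 0) =
      2 ^ m - 0 ^ m - 2 * m := by
  have h0 := sum_choose_mul_pow m (1 : ℤ)
  have h1 := sum_choose_mul_pow m (-1 : ℤ)
  have h2 := sum_choose_mul_ite_eq (n := m) (r := 1) (fun _ => 2)
    fun h => Or.inr (Nat.choose_eq_zero_of_lt h)
  simp only [one_pow, mul_one, Nat.choose_one_right] at h0 h2
  simp only [two_mul_odd_weight, mul_sub, sum_sub_distrib, mul_one, h0, h1, h2]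
  norm_num
  ring

theorem two_mul_card_oddCycles_two (m : ℕ) :
    2 * (#(oddCycles (m + 2) 2) : ℤ) =
      3 ^ (m + 2) - (-1) ^ (m + 2) - 2 * (m + 2) * 2 ^ (m + 1) - 4 * (m + 2).choose 3 := by
  have hw : ∀ k : ℕ, 2 * (if Odd k ∧ 5 ≤ k then (2 : ℤ) ^ k - 2 * k else 0) =
      2 ^ k - (-2) ^ k - 2 * (1 ^ k * k) + 2 * ((-1) ^ k * k) - if k = 3 then 4 else 0 := by
    intro k
    rcases Nat.even_or_odd k with h | h
    · have : k ≠ 3 := by rintro rfl; revert h; decide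
      simp [h.neg_one_pow, h.neg_pow, Nat.not_odd_iff_even.2 h, this]
    · by_cases h5 : 5 ≤ k
      · rw [if_pos ⟨h, h5⟩, if_neg (by omega), h.neg_one_pow, h.neg_pow]
        ring
      · have : k < 5 := by omega
        interval_cases k <;> revert h <;> decide
  rw [card_oddCycles_two, mul_sum]
  have hterm : ∀ k, 2 * (((m + 2).choose k : ℤ) *
      if Odd k ∧ 5 ≤ k then (2 : ℤ) ^ k - 2 * k else 0) =
      (m + 2).choose k * 2 ^ k - (m + 2).choose k * (-2) ^ k
        - 2 * ((m + 2).choose k * (1 ^ k * k)) + 2 * ((m + 2).choose k * ((-1) ^ k * k))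
        - (m + 2).choose k * if k = 3 then 4 else 0 := by
    intro k
    linear_combination ((m + 2).choose k : ℤ) * hw k
  have h3 := sum_choose_mul_ite_eq (n := m + 2) (r := 3) (fun _ => 4)
    fun h => Or.inr (Nat.choose_eq_zero_of_lt h)
  have h1 := sum_choose_mul_pow_mul (m + 1) (1 : ℤ)
  have h1' := sum_choose_mul_pow_mul (m + 1) (-1 : ℤ)
  simp only [hterm, sum_sub_distrib, sum_add_distrib, ← mul_sum]
  rw [h3, sum_choose_mul_pow, sum_choose_mul_pow, h1, h1']
  push_cast
  norm_num
  ring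

theorem card_oddCyclePairs_closed (m : ℕ) :
    (#(oddCyclePairs (m + 2)) : ℤ) =
      3 ^ (m + 2) + (-1) ^ (m + 2) - 2 - 4 * (m + 2) * 2 ^ (m + 1)
        + 4 * (m + 2) * (m + 1) := by
  rw [card_oddCyclePairs]
  simp only [sum_odd_weight]
  have hterm : ∀ k ∈ range (m + 2 + 1), ((m + 2).choose k : ℤ) *
      ((if Odd k ∧ 3 ≤ k then 2 else 0) *
        (2 ^ (m + 2 - k) - 0 ^ (m + 2 - k) - 2 * ((m + 2 - k : ℕ) : ℤ))) =
      1 ^ k * 2 ^ (m + 2 - k) * ((m + 2).choose k : ℤ)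
        - 1 ^ k * 0 ^ (m + 2 - k) * ((m + 2).choose k : ℤ)
        - (-1) ^ k * 2 ^ (m + 2 - k) * ((m + 2).choose k : ℤ)
        + (-1) ^ k * 0 ^ (m + 2 - k) * ((m + 2).choose k : ℤ)
        - 2 * (m + 2) * (((m + 2).choose k : ℤ) * 1 ^ k)
        + 2 * (((m + 2).choose k : ℤ) * (1 ^ k * k))
        + 2 * (m + 2) * (((m + 2).choose k : ℤ) * (-1) ^ k)
        - 2 * (((m + 2).choose k : ℤ) * ((-1) ^ k * k))
        - ((m + 2).choose k : ℤ) * (if k = 1 then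
          2 * (2 ^ (m + 2 - k) - 0 ^ (m + 2 - k) - 2 * ((m + 2 - k : ℕ) : ℤ)) else 0) := by
    intro k hk
    rw [two_mul_odd_weight, Nat.cast_sub (by rw [mem_range] at hk; omega)]
    push_cast
    split_ifs <;> ring
  have h1 := sum_choose_mul_ite_eq (n := m + 2) (r := 1)
    (fun k => 2 * (2 ^ (m + 2 - k) - 0 ^ (m + 2 - k) - 2 * ((m + 2 - k : ℕ) : ℤ)))
    (by omega)
  rw [sum_congr rfl hterm]
  simp only [sum_sub_distrib, sum_add_distrib, ← mul_sum]
  rw [h1, ← add_pow, ← add_pow, ← add_pow, ← add_pow, sum_choose_mul_pow, sum_choose_mul_pow,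
    sum_choose_mul_pow_mul (m + 1) (1 : ℤ), sum_choose_mul_pow_mul (m + 1) (-1 : ℤ),
    show m + 2 - 1 = m + 1 by omega]
  push_cast
  norm_num
  ring

theorem pCount_two (m : ℕ) :
    (pCount (m + 2) 2 : ℤ) = 3 ^ (m + 2) - 3 * (m + 2) * 2 ^ (m + 1)
      + 4 * (m + 2).choose 2 - 2 * (m + 2).choose 3 - 1 := by
  have h := congrArg (Nat.cast : ℕ → ℤ) (pCount_two_eq (n := m + 2))
  push_cast at h
  rw [two_mul_card_oddCycles_two, card_oddCyclePairs_closed] at h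
  refine mul_left_cancel₀ (two_ne_zero (α := ℤ)) ?_
  linear_combination h - 4 * choose_two_mul_two m

theorem ballot_eq_odd_order_two_descents (n : ℕ) (hn : 2 ≤ n) :
    bCount n 2 = pCount n 2 ∧
      (bCount n 2 : ℤ) =
        3 * eulerianNum (n - 1) 2 - 2 * n.choose 3 + n.choose 2 - 1 := by
  obtain ⟨m, rfl⟩ := Nat.exists_eq_add_of_le' hn
  refine ⟨?_, ?_⟩
  · exact_mod_cast (bCount_two m).trans (pCount_two m).symm
  · rw [bCount_two, show m + 2 - 1 = m + 1 by omega, eulerianNum_two]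
    ring
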